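/- Let M, a be reals with 0 ≤ a < M, let k, α, β be real constants with sin k ≠ 0, and define Θ = β + α( φ − cot k · ln(cscθ − cotθ) ) on U, where cscθ − cotθ = tan(θ/2) > 0 on (0,π). Let u : U → ℝ be a positive C² function depending only on (r,θ) with ∂_r u / u = (M − r − aα)/Δ and ∂_θ u / u = −cotθ. Then the 2-form F₁₀C = (u/√Δ)[ a sinθ sin k sinhΘ dt∧dr + Δ cos k coshΘ dt∧dθ − Δ sin k sinθ coshΘ dt∧dφ − ρ² cos k sinhΘ dr∧dθ + (r²+a²) sin k sinθ sinhΘ dr∧dφ + aΔ cos k sin²θ coshΘ dθ∧dφ ] is closed and force-free on U (F_{μν} j^ν = 0 for its current density j), and F₁₀C² := g^{μα}g^{νβ}F_{αβ}F_{μν} = −2u², so F₁₀C is electrically dominated. -/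

import Mathlib

noncomputable section

/-- Partial derivative of `f` in the coordinate direction `μ`,
coordinates `(x 0, x 1, x 2, x 3) = (t, r, θ, φ)`. -/
def pd (μ : Fin 4) (f : (Fin 4 → ℝ) → ℝ) (x : Fin 4 → ℝ) : ℝ :=
  fderiv ℝ f x (Pi.single μ 1)

/-- ρ² = r² + a² cos²θ. -/
def rho2 (a : ℝ) (x : Fin 4 → ℝ) : ℝ := (x 1) ^ 2 + a ^ 2 * Real.cos (x 2) ^ 2

/-- Δ = r² − 2Mr + a². -/
def Del (M a : ℝ) (x : Fin 4 → ℝ) : ℝ := (x 1) ^ 2 - 2 * M * (x 1) + a ^ 2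

/-- Σ² = (r²+a²)² − Δ a² sin²θ. -/
def Sig2 (M a : ℝ) (x : Fin 4 → ℝ) : ℝ :=
  ((x 1) ^ 2 + a ^ 2) ^ 2 - Del M a x * a ^ 2 * Real.sin (x 2) ^ 2

/-- The Kerr metric in Boyer–Lindquist coordinates `(t, r, θ, φ)`. -/
def kerr (M a : ℝ) (x : Fin 4 → ℝ) : Matrix (Fin 4) (Fin 4) ℝ :=
  Matrix.of fun μ ν =>
    if μ = 0 ∧ ν = 0 then -1 + 2 * M * (x 1) / rho2 a x
    else if (μ = 0 ∧ ν = 3) ∨ (μ = 3 ∧ ν = 0) then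
      -(2 * M * (x 1) * a * Real.sin (x 2) ^ 2) / rho2 a x
    else if μ = 1 ∧ ν = 1 then rho2 a x / Del M a x
    else if μ = 2 ∧ ν = 2 then rho2 a x
    else if μ = 3 ∧ ν = 3 then Sig2 M a x * Real.sin (x 2) ^ 2 / rho2 a x
    else 0

/-- The exterior Kerr domain U = {r > r₊, 0 < θ < π}. -/
def KerrExt (M a : ℝ) : Set (Fin 4 → ℝ) :=
  {x | M + Real.sqrt (M ^ 2 - a ^ 2) < x 1 ∧ 0 < x 2 ∧ x 2 < Real.pi}

/-- `wedge μ ν f` is the antisymmetric matrix of the 2-form `f dx^μ ∧ dx^ν`. -/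
def wedge (μ ν : Fin 4) (f : ℝ) : Matrix (Fin 4) (Fin 4) ℝ :=
  Matrix.of fun i j => if i = μ ∧ j = ν then f else if i = ν ∧ j = μ then -f else 0

/-- A 2-form `F` is closed on `S`: ∂_μ F_{νλ} + ∂_ν F_{λμ} + ∂_λ F_{μν} = 0. -/
def Closed2Form (F : (Fin 4 → ℝ) → Matrix (Fin 4) (Fin 4) ℝ) (S : Set (Fin 4 → ℝ)) : Prop :=
  ∀ x ∈ S, ∀ μ ν lam : Fin 4,
    pd μ (fun y => F y ν lam) x + pd ν (fun y => F y lam μ) x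
      + pd lam (fun y => F y μ ν) x = 0

/-- Current density j^μ = (ρ²sinθ)⁻¹ ∂_ν (ρ²sinθ g^{μα} g^{νβ} F_{αβ}). -/
def current (M a : ℝ) (F : (Fin 4 → ℝ) → Matrix (Fin 4) (Fin 4) ℝ)
    (x : Fin 4 → ℝ) (μ : Fin 4) : ℝ :=
  (rho2 a x * Real.sin (x 2))⁻¹ *
    ∑ ν : Fin 4, pd ν (fun y => rho2 a y * Real.sin (y 2) *
      ∑ i : Fin 4, ∑ j : Fin 4, (kerr M a y)⁻¹ μ i * (kerr M a y)⁻¹ ν j * F y i j) x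

/-- `F` is force-free on `S`: F_{μν} j^ν = 0 for the current density `j` of `F`. -/
def ForceFree (M a : ℝ) (F : (Fin 4 → ℝ) → Matrix (Fin 4) (Fin 4) ℝ)
    (S : Set (Fin 4 → ℝ)) : Prop :=
  ∀ x ∈ S, ∀ μ : Fin 4, ∑ ν : Fin 4, F x μ ν * current M a F x ν = 0

/-- The invariant F² = g^{μα} g^{νβ} F_{αβ} F_{μν}. -/
def Fsq (M a : ℝ) (F : (Fin 4 → ℝ) → Matrix (Fin 4) (Fin 4) ℝ) (x : Fin 4 → ℝ) : ℝ :=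
  ∑ μ : Fin 4, ∑ ν : Fin 4, ∑ i : Fin 4, ∑ j : Fin 4,
    (kerr M a x)⁻¹ μ i * (kerr M a x)⁻¹ ν j * F x i j * F x μ ν

/-- Θ = β + α( φ − cot k · ln(cscθ − cotθ) ). -/
def ThC (k α β : ℝ) (x : Fin 4 → ℝ) : ℝ :=
  β + α * (x 3 - Real.cos k / Real.sin k *
    Real.log ((Real.sin (x 2))⁻¹ - Real.cos (x 2) / Real.sin (x 2)))

/-- The 2-form F₁₀C. -/
def F10C (M a k α β : ℝ) (u : ℝ × ℝ → ℝ) (x : Fin 4 → ℝ) : Matrix (Fin 4) (Fin 4) ℝ :=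
  let TH := ThC k α β
  wedge 0 1 (u (x 1, x 2) / Real.sqrt (Del M a x) *
      (a * Real.sin (x 2) * Real.sin k * Real.sinh (TH x)))
    + wedge 0 2 (u (x 1, x 2) / Real.sqrt (Del M a x) *
      (Del M a x * Real.cos k * Real.cosh (TH x)))
    + wedge 0 3 (u (x 1, x 2) / Real.sqrt (Del M a x) *
      (-(Del M a x * Real.sin k * Real.sin (x 2) * Real.cosh (TH x))))
    + wedge 1 2 (u (x 1, x 2) / Real.sqrt (Del M a x) *
      (-(rho2 a x * Real.cos k * Real.sinh (TH x))))
    + wedge 1 3 (u (x 1, x 2) / Real.sqrt (Del M a x) *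
      (((x 1) ^ 2 + a ^ 2) * Real.sin k * Real.sin (x 2) * Real.sinh (TH x)))
    + wedge 2 3 (u (x 1, x 2) / Real.sqrt (Del M a x) *
      (a * Del M a x * Real.cos k * Real.sin (x 2) ^ 2 * Real.cosh (TH x)))

/-- `f` is differentiable at `x` with partial derivatives `d`. -/
def GD (f : (Fin 4 → ℝ) → ℝ) (x : Fin 4 → ℝ) (d : Fin 4 → ℝ) : Prop :=
  DifferentiableAt ℝ f x ∧ ∀ μ, pd μ f x = d μ

theorem GD.mul {f g : (Fin 4 → ℝ) → ℝ} {x : Fin 4 → ℝ} {d e : Fin 4 → ℝ}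
    (hf : GD f x d) (hg : GD g x e) :
    GD (fun y => f y * g y) x (fun μ => f x * e μ + g x * d μ) := by
  refine ⟨hf.1.mul hg.1, fun μ => ?_⟩
  beta_reduce
  rw [← hf.2, ← hg.2]
  simp only [pd]
  rw [fderiv_fun_mul hf.1 hg.1]
  simp

theorem GD.add {f g : (Fin 4 → ℝ) → ℝ} {x : Fin 4 → ℝ} {d e : Fin 4 → ℝ}
    (hf : GD f x d) (hg : GD g x e) :
    GD (fun y => f y + g y) x (fun μ => d μ + e μ) := by
  refine ⟨hf.1.add hg.1, fun μ => ?_⟩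
  beta_reduce
  rw [← hf.2, ← hg.2]
  simp only [pd]
  rw [fderiv_fun_add hf.1 hg.1]
  simp

theorem GD.const (c : ℝ) (x : Fin 4 → ℝ) : GD (fun _ => c) x (fun _ => 0) := by
  refine ⟨differentiableAt_const c, fun μ => ?_⟩
  simp [pd]

theorem GD.neg {f : (Fin 4 → ℝ) → ℝ} {x : Fin 4 → ℝ} {d : Fin 4 → ℝ}
    (hf : GD f x d) : GD (fun y => - f y) x (fun μ => - d μ) := by
  refine ⟨hf.1.neg, fun μ => ?_⟩
  beta_reduce
  rw [← hf.2]
  simp only [pd]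
  rw [fderiv_fun_neg]
  simp

theorem GD.coord (i : Fin 4) (x : Fin 4 → ℝ) :
    GD (fun y => y i) x (fun μ => if i = μ then 1 else 0) := by
  have h : HasFDerivAt (fun y : Fin 4 → ℝ => y i)
      (ContinuousLinearMap.proj (R := ℝ) (φ := fun _ : Fin 4 => ℝ) i) x :=
    (ContinuousLinearMap.proj (R := ℝ) (φ := fun _ : Fin 4 => ℝ) i).hasFDerivAt
  refine ⟨h.differentiableAt, fun μ => ?_⟩
  simp only [pd]
  rw [h.fderiv]
  simp [Pi.single_apply]

theorem GD.comp {f : (Fin 4 → ℝ) → ℝ} {x : Fin 4 → ℝ} {d : Fin 4 → ℝ} {g : ℝ → ℝ} {g' : ℝ}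
    (hg : HasDerivAt g g' (f x)) (hf : GD f x d) :
    GD (fun y => g (f y)) x (fun μ => g' * d μ) := by
  have h := hg.comp_hasFDerivAt x hf.1.hasFDerivAt
  refine ⟨h.differentiableAt, fun μ => ?_⟩
  beta_reduce
  rw [← hf.2]
  simp only [pd]
  have h2 : fderiv ℝ (fun y => g (f y)) x = g' • fderiv ℝ f x := h.fderiv
  rw [h2]
  simp

theorem GD.congr {f g : (Fin 4 → ℝ) → ℝ} {x : Fin 4 → ℝ} {d e : Fin 4 → ℝ}
    (hf : GD f x d) (h : ∀ᶠ y in nhds x, g y = f y) (hd : ∀ μ, d μ = e μ) : GD g x e := by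
  have hev : g =ᶠ[nhds x] f := h
  refine ⟨hf.1.congr_of_eventuallyEq hev, fun μ => ?_⟩
  rw [← hd, ← hf.2]
  simp only [pd]
  rw [hev.fderiv_eq]

/-- The combination `u sinθ / √Δ`. -/
def Wf (M a : ℝ) (u : ℝ × ℝ → ℝ) (x : Fin 4 → ℝ) : ℝ :=
  u (x 1, x 2) * Real.sin (x 2) * (Real.sqrt (Del M a x))⁻¹

theorem KerrExt.isOpen (M a : ℝ) : IsOpen (KerrExt M a) := by
  have h1 : Continuous fun x : Fin 4 → ℝ => x 1 := continuous_apply 1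
  have h2 : Continuous fun x : Fin 4 → ℝ => x 2 := continuous_apply 2
  exact (isOpen_lt continuous_const h1).inter
    ((isOpen_lt continuous_const h2).inter (isOpen_lt h2 continuous_const))

theorem Del_pos {M a : ℝ} (ha : 0 ≤ a) (haM : a < M) {x : Fin 4 → ℝ}
    (hx : x ∈ KerrExt M a) : 0 < Del M a x := by
  have h := hx.1
  have h0 : 0 ≤ M ^ 2 - a ^ 2 := by nlinarith
  have hs := Real.sq_sqrt h0
  have hn := Real.sqrt_nonneg (M ^ 2 - a ^ 2)
  unfold Del
  nlinarith

theorem rho2_pos {M a : ℝ} (ha : 0 ≤ a) (haM : a < M) {x : Fin 4 → ℝ}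
    (hx : x ∈ KerrExt M a) : 0 < rho2 a x := by
  have h := hx.1
  have hn := Real.sqrt_nonneg (M ^ 2 - a ^ 2)
  have : 0 < x 1 := by linarith
  unfold rho2
  positivity

theorem sin_pos_ext {M a : ℝ} {x : Fin 4 → ℝ}
    (hx : x ∈ KerrExt M a) : 0 < Real.sin (x 2) :=
  Real.sin_pos_of_pos_of_lt_pi hx.2.1 hx.2.2

theorem GD.Del (M a : ℝ) (x : Fin 4 → ℝ) :
    GD (Del M a) x ![0, 2 * x 1 - 2 * M, 0, 0] := by
  refine ((((GD.coord 1 x).mul (GD.coord 1 x)).add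
    ((GD.const (-2 * M) x).mul (GD.coord 1 x))).add (GD.const (a ^ 2) x)).congr
    (Filter.Eventually.of_forall fun y => ?_) fun μ => ?_
  · simp only [_root_.Del]; ring
  · fin_cases μ <;> simp <;> ring

theorem GD.rho2 (a : ℝ) (x : Fin 4 → ℝ) :
    GD (rho2 a) x ![0, 2 * x 1, -2 * a ^ 2 * Real.cos (x 2) * Real.sin (x 2), 0] := by
  have hc := GD.comp (Real.hasDerivAt_cos (x 2)) (GD.coord 2 x)
  refine (((GD.coord 1 x).mul (GD.coord 1 x)).add
    ((GD.const (a ^ 2) x).mul (hc.mul hc))).congr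
    (Filter.Eventually.of_forall fun y => ?_) fun μ => ?_
  · simp only [_root_.rho2]; ring
  · fin_cases μ <;> simp <;> ring

theorem GD.sin (x : Fin 4 → ℝ) :
    GD (fun y => Real.sin (y 2)) x ![0, 0, Real.cos (x 2), 0] := by
  refine (GD.comp (Real.hasDerivAt_sin (x 2)) (GD.coord 2 x)).congr
    (Filter.Eventually.of_forall fun y => rfl) fun μ => ?_
  fin_cases μ <;> simp

theorem GD.sininv (x : Fin 4 → ℝ) (h : Real.sin (x 2) ≠ 0) :
    GD (fun y => (Real.sin (y 2))⁻¹) x ![0, 0, -Real.cos (x 2) / Real.sin (x 2) ^ 2, 0] := by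
  refine (GD.comp (hasDerivAt_inv h) (GD.sin x)).congr
    (Filter.Eventually.of_forall fun y => rfl) fun μ => ?_
  fin_cases μ <;> simp; ring

theorem GD.r2 (a : ℝ) (x : Fin 4 → ℝ) :
    GD (fun y => y 1 ^ 2 + a ^ 2) x ![0, 2 * x 1, 0, 0] := by
  refine (((GD.coord 1 x).mul (GD.coord 1 x)).add (GD.const (a ^ 2) x)).congr
    (Filter.Eventually.of_forall fun y => ?_) fun μ => ?_
  · ring
  · fin_cases μ <;> simp; ring

theorem GD.ThC (k α β : ℝ) (x : Fin 4 → ℝ) (h : 0 < Real.sin (x 2)) :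
    GD (ThC k α β) x
      ![0, 0, -α * (Real.cos k / Real.sin k) / Real.sin (x 2), α] := by
  have hs := h.ne'
  have hc : Real.cos (x 2) < 1 := by
    nlinarith [Real.sin_sq_add_cos_sq (x 2), Real.cos_le_one (x 2)]
  have hpos : 0 < (Real.sin (x 2))⁻¹ - Real.cos (x 2) / Real.sin (x 2) := by
    have : (Real.sin (x 2))⁻¹ - Real.cos (x 2) / Real.sin (x 2)
      = (1 - Real.cos (x 2)) / Real.sin (x 2) := by ring
    rw [this]
    exact div_pos (by linarith) h
  have hd : HasDerivAt (fun t => Real.log ((Real.sin t)⁻¹ - Real.cos t / Real.sin t))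
      ((Real.sin (x 2))⁻¹) (x 2) := by
    have h1 := (((Real.hasDerivAt_sin (x 2)).inv hs).sub
      ((Real.hasDerivAt_cos (x 2)).div (Real.hasDerivAt_sin (x 2)) hs)).log hpos.ne'
    refine h1.congr_deriv ?_
    have h2 : (1 - Real.cos (x 2)) ≠ 0 := by linarith
    simp only [Pi.sub_apply, Pi.inv_apply, Pi.div_apply]
    rw [div_eq_iff hpos.ne']
    field_simp
    linear_combination Real.sin_sq_add_cos_sq (x 2)
  refine ((GD.const β x).add ((GD.const α x).mul ((GD.coord 3 x).add
    ((GD.const (-(Real.cos k / Real.sin k)) x).mul (GD.comp hd (GD.coord 2 x)))))).congr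
    (Filter.Eventually.of_forall fun y => ?_) fun μ => ?_
  · simp only [_root_.ThC]; ring
  · fin_cases μ <;> simp; ring

theorem GD.Wf (M a α : ℝ) (ha : 0 ≤ a) (haM : a < M)
    (u : ℝ × ℝ → ℝ)
    (hu : ContDiffOn ℝ 2 u
      (Set.Ioi (M + Real.sqrt (M ^ 2 - a ^ 2)) ×ˢ Set.Ioo 0 Real.pi))
    (hur : ∀ p ∈ Set.Ioi (M + Real.sqrt (M ^ 2 - a ^ 2)) ×ˢ Set.Ioo 0 Real.pi,
      fderiv ℝ u p (1, 0)
        = u p * ((M - p.1 - a * α) / (p.1 ^ 2 - 2 * M * p.1 + a ^ 2)))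
    (hut : ∀ p ∈ Set.Ioi (M + Real.sqrt (M ^ 2 - a ^ 2)) ×ˢ Set.Ioo 0 Real.pi,
      fderiv ℝ u p (0, 1) = u p * (-(Real.cos p.2 / Real.sin p.2)))
    (x : Fin 4 → ℝ) (hx : x ∈ KerrExt M a) :
    GD (Wf M a u) x
      ![0, Wf M a u x * (2 * M - 2 * x 1 - a * α) / _root_.Del M a x, 0, 0] := by
  have hD := Del_pos ha haM hx
  have hs := sin_pos_ext hx
  have hp : (x 1, x 2) ∈ Set.Ioi (M + Real.sqrt (M ^ 2 - a ^ 2)) ×ˢ Set.Ioo 0 Real.pi :=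
    ⟨hx.1, hx.2.1, hx.2.2⟩
  have hud : DifferentiableAt ℝ u (x 1, x 2) :=
    (hu.contDiffAt ((isOpen_Ioi.prod isOpen_Ioo).mem_nhds hp)).differentiableAt (by norm_num)
  have hv : GD (fun y : Fin 4 → ℝ => u (y 1, y 2)) x
      ![0, u (x 1, x 2) * ((M - x 1 - a * α) / _root_.Del M a x),
        u (x 1, x 2) * (-(Real.cos (x 2) / Real.sin (x 2))), 0] := by
    have hl : HasFDerivAt (fun y : Fin 4 → ℝ => (y 1, y 2))
      ((ContinuousLinearMap.proj (R := ℝ) (φ := fun _ : Fin 4 => ℝ) 1).prod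
        (ContinuousLinearMap.proj (R := ℝ) (φ := fun _ : Fin 4 => ℝ) 2)) x :=
      ((ContinuousLinearMap.proj (R := ℝ) (φ := fun _ : Fin 4 => ℝ) 1).prod
        (ContinuousLinearMap.proj (R := ℝ) (φ := fun _ : Fin 4 => ℝ) 2)).hasFDerivAt
    have hh : HasFDerivAt (fun y : Fin 4 → ℝ => u (y 1, y 2)) _ x :=
      HasFDerivAt.comp (g := u) x hud.hasFDerivAt hl
    refine ⟨hh.differentiableAt, fun μ => ?_⟩
    have h1 := hur _ hp
    have h2 := hut _ hp
    have h0 : fderiv ℝ u (x 1, x 2) (0, 0) = 0 := map_zero _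
    simp only [pd]
    rw [hh.fderiv]
    simp only [ContinuousLinearMap.comp_apply, ContinuousLinearMap.prod_apply,
      ContinuousLinearMap.proj_apply]
    fin_cases μ
    · simpa using h0
    · simpa [_root_.Del] using h1
    · simpa using h2
    · simpa using h0
  have hsq : 0 < Real.sqrt (_root_.Del M a x) := Real.sqrt_pos.2 hD
  have hq := GD.comp (((Real.hasDerivAt_sqrt hD.ne').inv hsq.ne')) (GD.Del M a x)
  refine ((hv.mul (GD.sin x)).mul hq).congr
    (Filter.Eventually.of_forall fun y => rfl) fun μ => ?_
  have e : Real.sqrt (_root_.Del M a x) ^ 2 = _root_.Del M a x := Real.sq_sqrt hD.le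
  fin_cases μ
  · simp
  · simp only [_root_.Wf]
    simp
    rw [e]
    field_simp
    ring
  · simp
    right
    field_simp
    ring
  · simp

/-- Explicit components of the 2-form on the exterior domain. -/
def FE (M a k α β : ℝ) (u : ℝ × ℝ → ℝ) (x : Fin 4 → ℝ) : Matrix (Fin 4) (Fin 4) ℝ :=
  let W := Wf M a u x
  let S := Real.sinh (ThC k α β x)
  let C := Real.cosh (ThC k α β x)
  let s := Real.sin (x 2)
  let D := Del M a x
  let A := a * Real.sin k * (S * W)
  let B := Real.cos k * (D * (C * (W * s⁻¹)))
  let E := -Real.sin k * (D * (C * W))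
  let G := -Real.cos k * (rho2 a x * (S * (W * s⁻¹)))
  let H := Real.sin k * ((x 1 ^ 2 + a ^ 2) * (S * W))
  let K := a * Real.cos k * (D * (s * (C * W)))
  !![0, A, B, E; -A, 0, G, H; -B, -G, 0, K; -E, -H, -K, 0]

/-- Explicit components of the densitized raised 2-form. -/
def HE (M a k α β : ℝ) (u : ℝ × ℝ → ℝ) (x : Fin 4 → ℝ) : Matrix (Fin 4) (Fin 4) ℝ :=
  let W := Wf M a u x
  let S := Real.sinh (ThC k α β x)
  let C := Real.cosh (ThC k α β x)
  let s := Real.sin (x 2)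
  let D := Del M a x
  let A := -(a * Real.sin k) * (D * (s * (S * W)))
  let B := -Real.cos k * ((x 1 ^ 2 + a ^ 2) * (C * W))
  let E := Real.sin k * (rho2 a x * (C * (W * s⁻¹)))
  let G := -Real.cos k * (D * (S * W))
  let H := Real.sin k * (D * (S * (W * s⁻¹)))
  let K := a * Real.cos k * (C * W)
  !![0, A, B, E; -A, 0, G, H; -B, -G, 0, K; -E, -H, -K, 0]

theorem F10C_eq (M a k α β : ℝ) (u : ℝ × ℝ → ℝ) (x : Fin 4 → ℝ)
    (h : 0 < Real.sin (x 2)) : F10C M a k α β u x = FE M a k α β u x := by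
  have hs := h.ne'
  ext i j
  fin_cases i <;> fin_cases j <;> simp [F10C, FE, wedge, Wf] <;> field_simp

/-- Explicit inverse Kerr metric. -/
def kinv (M a : ℝ) (x : Fin 4 → ℝ) : Matrix (Fin 4) (Fin 4) ℝ :=
  !![-Sig2 M a x / (rho2 a x * Del M a x), 0, 0, -(2 * M * x 1 * a) / (rho2 a x * Del M a x);
    0, Del M a x / rho2 a x, 0, 0;
    0, 0, 1 / rho2 a x, 0;
    -(2 * M * x 1 * a) / (rho2 a x * Del M a x), 0, 0,
      (Del M a x - a ^ 2 * Real.sin (x 2) ^ 2) /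
        (rho2 a x * Del M a x * Real.sin (x 2) ^ 2)]

theorem kerr_inv (M a : ℝ) (x : Fin 4 → ℝ) (hD : Del M a x ≠ 0) (hr : rho2 a x ≠ 0)
    (hs : Real.sin (x 2) ≠ 0) : (kerr M a x)⁻¹ = kinv M a x := by
  apply Matrix.inv_eq_right_inv
  have e : Real.cos (x 2) ^ 2 = 1 - Real.sin (x 2) ^ 2 := by
    linarith [Real.sin_sq_add_cos_sq (x 2)]
  have er : rho2 a x = x 1 ^ 2 + a ^ 2 - a ^ 2 * Real.sin (x 2) ^ 2 := by
    rw [rho2, e]; ring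
  have eD : Del M a x = x 1 ^ 2 - 2 * M * x 1 + a ^ 2 := rfl
  ext i j
  fin_cases i <;> fin_cases j <;>
    simp [kerr, kinv, Matrix.mul_apply, Fin.sum_univ_four] <;> field_simp <;>
    (try simp only [Sig2]) <;> (try rw [er]) <;> (try rw [eD]) <;> ring

theorem raise (M a k α β : ℝ) (u : ℝ × ℝ → ℝ) (x : Fin 4 → ℝ) (hD : Del M a x ≠ 0)
    (hr : rho2 a x ≠ 0) (hs : Real.sin (x 2) ≠ 0) (μ ν : Fin 4) :
    rho2 a x * Real.sin (x 2) *
      ∑ i : Fin 4, ∑ j : Fin 4, kinv M a x μ i * kinv M a x ν j * FE M a k α β u x i j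
      = HE M a k α β u x μ ν := by
  have e : Real.cos (x 2) ^ 2 = 1 - Real.sin (x 2) ^ 2 := by
    linarith [Real.sin_sq_add_cos_sq (x 2)]
  have er : rho2 a x = x 1 ^ 2 + a ^ 2 - a ^ 2 * Real.sin (x 2) ^ 2 := by
    rw [rho2, e]; ring
  have eD : Del M a x = x 1 ^ 2 - 2 * M * x 1 + a ^ 2 := rfl
  fin_cases μ <;> fin_cases ν <;>
    simp [HE, FE, kinv, Fin.sum_univ_four, hr, hs] <;> field_simp <;>
    (try simp only [Sig2]) <;> (try rw [er]) <;> (try rw [eD]) <;> ring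

theorem antisym_pd {A B E G H K : (Fin 4 → ℝ) → ℝ} {x : Fin 4 → ℝ}
    {dA dB dE dG dH dK : Fin 4 → ℝ} (hA : GD A x dA) (hB : GD B x dB) (hE : GD E x dE)
    (hG : GD G x dG) (hH : GD H x dH) (hK : GD K x dK) (μ i j : Fin 4) :
    pd μ (fun y => (!![0, A y, B y, E y; -A y, 0, G y, H y; -B y, -G y, 0, K y;
      -E y, -H y, -K y, 0] : Matrix (Fin 4) (Fin 4) ℝ) i j) x =
    (!![0, dA μ, dB μ, dE μ; -dA μ, 0, dG μ, dH μ; -dB μ, -dG μ, 0, dK μ;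
      -dE μ, -dH μ, -dK μ, 0] : Matrix (Fin 4) (Fin 4) ℝ) i j := by
  fin_cases i <;> fin_cases j
  · exact (GD.const 0 x).2 μ
  · exact hA.2 μ
  · exact hB.2 μ
  · exact hE.2 μ
  · exact hA.neg.2 μ
  · exact (GD.const 0 x).2 μ
  · exact hG.2 μ
  · exact hH.2 μ
  · exact hB.neg.2 μ
  · exact hG.neg.2 μ
  · exact (GD.const 0 x).2 μ
  · exact hK.2 μ
  · exact hE.neg.2 μ
  · exact hH.neg.2 μ
  · exact hK.neg.2 μ
  · exact (GD.const 0 x).2 μ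

/-- F₁₀C is closed and force-free on U, and F₁₀C² = −2u², so F₁₀C is
electrically dominated. -/
theorem kerr_F10C_forcefree (M a k α β : ℝ) (ha : 0 ≤ a) (haM : a < M)
    (hk : Real.sin k ≠ 0)
    (u : ℝ × ℝ → ℝ)
    (hu : ContDiffOn ℝ 2 u
      (Set.Ioi (M + Real.sqrt (M ^ 2 - a ^ 2)) ×ˢ Set.Ioo 0 Real.pi))
    (hupos : ∀ p ∈ Set.Ioi (M + Real.sqrt (M ^ 2 - a ^ 2)) ×ˢ Set.Ioo 0 Real.pi,
      0 < u p)
    (hur : ∀ p ∈ Set.Ioi (M + Real.sqrt (M ^ 2 - a ^ 2)) ×ˢ Set.Ioo 0 Real.pi,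
      fderiv ℝ u p (1, 0)
        = u p * ((M - p.1 - a * α) / (p.1 ^ 2 - 2 * M * p.1 + a ^ 2)))
    (hut : ∀ p ∈ Set.Ioi (M + Real.sqrt (M ^ 2 - a ^ 2)) ×ˢ Set.Ioo 0 Real.pi,
      fderiv ℝ u p (0, 1) = u p * (-(Real.cos p.2 / Real.sin p.2))) :
    Closed2Form (F10C M a k α β u) (KerrExt M a) ∧
    ForceFree M a (F10C M a k α β u) (KerrExt M a) ∧
    ∀ x ∈ KerrExt M a, Fsq M a (F10C M a k α β u) x = -2 * u (x 1, x 2) ^ 2 := by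
  have hF : ∀ x ∈ KerrExt M a, F10C M a k α β u x = FE M a k α β u x := fun x hx =>
    F10C_eq M a k α β u x (sin_pos_ext hx)
  have hnh : ∀ x ∈ KerrExt M a, ∀ᶠ y in nhds x, y ∈ KerrExt M a := fun x hx =>
    (KerrExt.isOpen M a).mem_nhds hx
  have hR : ∀ x ∈ KerrExt M a, ∀ μ ν, rho2 a x * Real.sin (x 2) *
      ∑ i : Fin 4, ∑ j : Fin 4, (kerr M a x)⁻¹ μ i * (kerr M a x)⁻¹ ν j *
        F10C M a k α β u x i j = HE M a k α β u x μ ν := by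
    intro x hx μ ν
    have hD := (Del_pos ha haM hx).ne'
    have hr := (rho2_pos ha haM hx).ne'
    have hs := (sin_pos_ext hx).ne'
    rw [hF x hx, kerr_inv M a x hD hr hs]
    exact raise M a k α β u x hD hr hs μ ν
  refine ⟨?_, ?_, ?_⟩
  · intro x hx μ ν lam
    have hD := (Del_pos ha haM hx).ne'
    have hs := (sin_pos_ext hx).ne'
    have hpF : ∀ μ i j, pd μ (fun y => F10C M a k α β u y i j) x
        = pd μ (fun y => FE M a k α β u y i j) x := by
      intro μ i j
      have : (fun y => F10C M a k α β u y i j) =ᶠ[nhds x] (fun y => FE M a k α β u y i j) := by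
        filter_upwards [hnh x hx] with y hy
        rw [hF y hy]
      simp only [pd, this.fderiv_eq]
    have gW := GD.Wf M a α ha haM u hu hur hut x hx
    have gT := GD.ThC k α β x (sin_pos_ext hx)
    have gS := GD.comp (Real.hasDerivAt_sinh _) gT
    have gC := GD.comp (Real.hasDerivAt_cosh _) gT
    have gD := GD.Del M a x
    have gi := GD.sininv x hs
    have A := ((GD.const (a * Real.sin k) x).mul (gS.mul gW))
    have B := ((GD.const (Real.cos k) x).mul (gD.mul (gC.mul (gW.mul gi))))
    have E := ((GD.const (-Real.sin k) x).mul (gD.mul (gC.mul gW)))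
    have G := ((GD.const (-Real.cos k) x).mul ((GD.rho2 a x).mul (gS.mul (gW.mul gi))))
    have H := ((GD.const (Real.sin k) x).mul ((GD.r2 a x).mul (gS.mul gW)))
    have K := ((GD.const (a * Real.cos k) x).mul (gD.mul ((GD.sin x).mul (gC.mul gW))))
    have T : ∀ μ i j, pd μ (fun y => FE M a k α β u y i j) x = _ :=
      antisym_pd A B E G H K
    rw [hpF, hpF, hpF, T, T, T]
    have e : Real.cos (x 2) ^ 2 = 1 - Real.sin (x 2) ^ 2 := by
      linarith [Real.sin_sq_add_cos_sq (x 2)]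
    have er : rho2 a x = x 1 ^ 2 + a ^ 2 - a ^ 2 * Real.sin (x 2) ^ 2 := by
      rw [rho2, e]; ring
    fin_cases μ <;> fin_cases ν <;> fin_cases lam <;>
      simp <;> field_simp <;>
      (try rw [er]) <;> ring
  · intro x hx μ
    have hD := (Del_pos ha haM hx).ne'
    have hr := (rho2_pos ha haM hx).ne'
    have hs := (sin_pos_ext hx).ne'
    have hpF : ∀ ν μ, pd ν (fun y => rho2 a y * Real.sin (y 2) *
        ∑ i : Fin 4, ∑ j : Fin 4, (kerr M a y)⁻¹ μ i * (kerr M a y)⁻¹ ν j *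
          F10C M a k α β u y i j) x = pd ν (fun y => HE M a k α β u y μ ν) x := by
      intro ν μ
      have : (fun y => rho2 a y * Real.sin (y 2) *
        ∑ i : Fin 4, ∑ j : Fin 4, (kerr M a y)⁻¹ μ i * (kerr M a y)⁻¹ ν j *
          F10C M a k α β u y i j) =ᶠ[nhds x] (fun y => HE M a k α β u y μ ν) := by
        filter_upwards [hnh x hx] with y hy
        exact hR y hy μ ν
      simp only [pd, this.fderiv_eq]
    have gW := GD.Wf M a α ha haM u hu hur hut x hx
    have gT := GD.ThC k α β x (sin_pos_ext hx)
    have gS := GD.comp (Real.hasDerivAt_sinh _) gT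
    have gC := GD.comp (Real.hasDerivAt_cosh _) gT
    have gD := GD.Del M a x
    have gi := GD.sininv x hs
    have A := ((GD.const (-(a * Real.sin k)) x).mul (gD.mul ((GD.sin x).mul (gS.mul gW))))
    have B := ((GD.const (-Real.cos k) x).mul ((GD.r2 a x).mul (gC.mul gW)))
    have E := ((GD.const (Real.sin k) x).mul ((GD.rho2 a x).mul (gC.mul (gW.mul gi))))
    have G := ((GD.const (-Real.cos k) x).mul (gD.mul (gS.mul gW)))
    have H := ((GD.const (Real.sin k) x).mul (gD.mul (gS.mul (gW.mul gi))))
    have K := ((GD.const (a * Real.cos k) x).mul (gC.mul gW))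
    have T : ∀ μ i j, pd μ (fun y => HE M a k α β u y i j) x = _ :=
      antisym_pd A B E G H K
    have e : Real.cos (x 2) ^ 2 = 1 - Real.sin (x 2) ^ 2 := by
      linarith [Real.sin_sq_add_cos_sq (x 2)]
    have er : rho2 a x = x 1 ^ 2 + a ^ 2 - a ^ 2 * Real.sin (x 2) ^ 2 := by
      rw [rho2, e]; ring
    have ek : Real.cos k ^ 2 = 1 - Real.sin k ^ 2 := by
      linarith [Real.sin_sq_add_cos_sq k]
    set P := (rho2 a x * Real.sin (x 2))⁻¹ with hP
    set V := α * Wf M a u x / (Real.sin (x 2) * Real.sin k) with hV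
    have j0 : current M a (F10C M a k α β u) x 0
        = P * (V * Real.sinh (ThC k α β x) * (x 1 ^ 2 + a ^ 2)) := by
      simp only [current, hpF, T, ← hP, hV]
      congr 1
      simp [Fin.sum_univ_four]
      field_simp
      rw [er, ek]
      ring
    have j1 : current M a (F10C M a k α β u) x 1
        = P * (V * Real.cosh (ThC k α β x) * Del M a x) := by
      simp only [current, hpF, T, ← hP, hV]
      congr 1
      simp [Fin.sum_univ_four]
      field_simp
      rw [ek]
      ring
    have j2 : current M a (F10C M a k α β u) x 2 = 0 := by
      simp only [current, hpF, T, ← hP]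
      refine mul_eq_zero_of_right _ ?_
      simp [Fin.sum_univ_four]
      field_simp
      ring
    have j3 : current M a (F10C M a k α β u) x 3
        = P * (V * Real.sinh (ThC k α β x) * a) := by
      simp only [current, hpF, T, ← hP, hV]
      congr 1
      simp [Fin.sum_univ_four]
      field_simp
      rw [ek]
      ring
    clear_value P V
    rw [Fin.sum_univ_four, j0, j1, j2, j3, hF x hx]
    fin_cases μ <;> simp [FE] <;> field_simp <;> (try rw [er]) <;> ring
  · intro x hx
    have hD := (Del_pos ha haM hx)
    have hD' := hD.ne'
    have hr := (rho2_pos ha haM hx).ne'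
    have hs := (sin_pos_ext hx).ne'
    have h1 : rho2 a x * Real.sin (x 2) * Fsq M a (F10C M a k α β u) x
        = ∑ μ : Fin 4, ∑ ν : Fin 4, HE M a k α β u x μ ν * FE M a k α β u x μ ν := by
      simp only [← hR x hx, ← hF x hx, Fsq, Finset.mul_sum, Finset.sum_mul, mul_assoc]
    apply mul_left_cancel₀ (mul_ne_zero hr hs)
    rw [h1]
    have e : Real.cos (x 2) ^ 2 = 1 - Real.sin (x 2) ^ 2 := by
      linarith [Real.sin_sq_add_cos_sq (x 2)]
    have er : rho2 a x = x 1 ^ 2 + a ^ 2 - a ^ 2 * Real.sin (x 2) ^ 2 := by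
      rw [rho2, e]; ring
    have ek : Real.cos k ^ 2 = 1 - Real.sin k ^ 2 := by
      linarith [Real.sin_sq_add_cos_sq k]
    have ew : u (x 1, x 2) ^ 2 = Wf M a u x ^ 2 * Del M a x / Real.sin (x 2) ^ 2 := by
      have hsq : Real.sqrt (Del M a x) ≠ 0 := (Real.sqrt_pos.2 hD).ne'
      have e2 := Real.sq_sqrt hD.le
      rw [Wf, mul_pow, inv_pow, e2]
      field_simp
    have eC : Real.cosh (ThC k α β x) ^ 2 = Real.sinh (ThC k α β x) ^ 2 + 1 :=
      Real.cosh_sq _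
    rw [ew]
    simp [HE, FE, Fin.sum_univ_four]
    field_simp
    rw [er]
    ring_nf
    simp only [eC, ek]
    ring
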